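/- Let μ be a distribution on Q_d with w_i^0 > 1/2 for all i ∈ {1,...,d}. Then the two-player Voronoi game on Q_d with distribution μ has an equilibrium if and only if 𝟎 is a best response to 𝟎, i.e. P1(𝟎,𝟎) ≥ P1(A',𝟎) for all A' ∈ Q_d. -/

import Mathlib

open Finset

/-- Hamming distance on the hypercube `{0,1}^d` (modelled as `Fin d → Bool`). -/
def hamming {d : ℕ} (X Y : Fin d → Bool) : ℕ :=
  (Finset.univ.filter (fun i => X i ≠ Y i)).card

/-- Number of 1-coordinates of a point of the hypercube. -/
def nOnes {d : ℕ} (X : Fin d → Bool) : ℕ :=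
  (Finset.univ.filter (fun i => X i = true)).card

/-- `μ` is a probability distribution on the hypercube. -/
def IsDistribution {d : ℕ} (μ : (Fin d → Bool) → ℝ) : Prop :=
  (∀ X, 0 ≤ μ X) ∧ ∑ X : Fin d → Bool, μ X = 1

open Classical in
/-- The weight of a set of points under `μ`. -/
noncomputable def wt {d : ℕ} (μ : (Fin d → Bool) → ℝ) (S : Set (Fin d → Bool)) : ℝ :=
  ∑ X : Fin d → Bool, if X ∈ S then μ X else 0

/-- Payoff to player 1, positioned at `A`, against player 2 positioned at `B`. -/
noncomputable def P1 {d : ℕ} (μ : (Fin d → Bool) → ℝ) (A B : Fin d → Bool) : ℝ :=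
  wt μ {X | hamming X A < hamming X B} + (1/2) * wt μ {X | hamming X A = hamming X B}

/-- Payoff to player 2, positioned at `B`, against player 1 positioned at `A`. -/
noncomputable def P2 {d : ℕ} (μ : (Fin d → Bool) → ℝ) (A B : Fin d → Bool) : ℝ :=
  wt μ {X | hamming X B < hamming X A} + (1/2) * wt μ {X | hamming X A = hamming X B}

/-- `(A,B)` is an equilibrium: neither player can strictly improve by moving. -/
def IsEquilibrium {d : ℕ} (μ : (Fin d → Bool) → ℝ) (A B : Fin d → Bool) : Prop :=
  (∀ A', P1 μ A' B ≤ P1 μ A B) ∧ (∀ B', P2 μ A B' ≤ P2 μ A B)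

/-- `w_i^0`: the weight of the subcube where coordinate `i` equals 0. -/
noncomputable def w0 {d : ℕ} (μ : (Fin d → Bool) → ℝ) (i : Fin d) : ℝ :=
  wt μ {X | X i = false}

/-- The all-zeros point `𝟎`. -/
def zeroPt (d : ℕ) : Fin d → Bool := fun _ => false

/-- The all-ones point `𝟏`. -/
def onePt (d : ℕ) : Fin d → Bool := fun _ => true

theorem wt_nonneg {d : ℕ} {μ : (Fin d → Bool) → ℝ} (hμ : ∀ X, 0 ≤ μ X)
    (S : Set (Fin d → Bool)) : 0 ≤ wt μ S :=
  Finset.sum_nonneg fun X _ => by split_ifs <;> simp [hμ X]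

theorem wt_mono {d : ℕ} {μ : (Fin d → Bool) → ℝ} (hμ : ∀ X, 0 ≤ μ X)
    {S T : Set (Fin d → Bool)} (h : S ⊆ T) : wt μ S ≤ wt μ T := by
  classical
  refine Finset.sum_le_sum fun X _ => ?_
  by_cases hS : X ∈ S
  · simp [hS, h hS]
  · by_cases hT : X ∈ T <;> simp [hS, hT, hμ X]

/-- The game is symmetric between the two players. -/
theorem P2_eq_P1_swap {d : ℕ} (μ : (Fin d → Bool) → ℝ) (A B : Fin d → Bool) :
    P2 μ A B = P1 μ B A := by
  simp only [P1, P2, eq_comm]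

/-- The game is constant-sum. -/
theorem P1_add_P1_swap {d : ℕ} {μ : (Fin d → Bool) → ℝ} (hμ : ∑ X, μ X = 1)
    (A B : Fin d → Bool) : P1 μ A B + P1 μ B A = 1 := by
  simp only [P1, wt, Finset.mul_sum, ← Finset.sum_add_distrib, Set.mem_ofPred_eq]
  refine Eq.trans (Finset.sum_congr rfl fun X _ => ?_) hμ
  rcases lt_trichotomy (hamming X A) (hamming X B) with h | h | h
  · simp [h, h.ne, h.ne', h.not_gt]
  · simp only [h, lt_irrefl, if_true, if_false]
    ring
  · simp [h, h.ne, h.ne', h.not_gt]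

theorem P1_self {d : ℕ} {μ : (Fin d → Bool) → ℝ} (hμ : ∑ X, μ X = 1)
    (A : Fin d → Bool) : P1 μ A A = 1 / 2 := by
  linarith [P1_add_P1_swap hμ A A]

theorem hamming_update_false_lt {d : ℕ} {X B : Fin d → Bool} {i : Fin d}
    (hX : X i = false) (hB : B i = true) :
    hamming X (Function.update B i false) < hamming X B := by
  refine Finset.card_lt_card (Finset.ssubset_iff_of_subset ?_ |>.2 ⟨i, ?_, ?_⟩)
  · intro j hj
    by_cases hji : j = i
    · subst hji
      simp [hX] at hj
    · simpa [hji] using hj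
  · simp [hX, hB]
  · simp [hX]

theorem w0_le_P1_update {d : ℕ} {μ : (Fin d → Bool) → ℝ} (hμ : ∀ X, 0 ≤ μ X)
    {B : Fin d → Bool} {i : Fin d} (hB : B i = true) :
    w0 μ i ≤ P1 μ (Function.update B i false) B := by
  have h := wt_mono hμ (S := {X | X i = false})
    (T := {X | hamming X (Function.update B i false) < hamming X B})
    fun X hX => hamming_update_false_lt hX hB
  have h' := wt_nonneg hμ {X | hamming X (Function.update B i false) = hamming X B}
  simp only [w0, P1]
  linarith

theorem statement_8 (d : ℕ) (μ : (Fin d → Bool) → ℝ) (hμ : IsDistribution μ)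
    (hw : ∀ i, (1:ℝ)/2 < w0 μ i) :
    (∃ A B : Fin d → Bool, IsEquilibrium μ A B) ↔
      (∀ A' : Fin d → Bool, P1 μ A' (zeroPt d) ≤ P1 μ (zeroPt d) (zeroPt d)) := by
  obtain ⟨hnonneg, hsum⟩ := hμ
  constructor
  · rintro ⟨A, B, hA, hB⟩
    have hAB : P1 μ A B ≤ 1 / 2 := by
      have h := hB A
      rw [P2_eq_P1_swap, P2_eq_P1_swap, P1_self hsum] at h
      linarith [P1_add_P1_swap hsum A B]
    have hzero : B = zeroPt d := by
      funext i
      by_contra hi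
      have hBi : B i = true := by simpa [zeroPt] using hi
      linarith [hA (Function.update B i false), w0_le_P1_update hnonneg hBi, hw i]
    subst hzero
    intro A'
    rw [P1_self hsum]
    exact (hA A').trans hAB
  · intro h
    refine ⟨zeroPt d, zeroPt d, h, fun B' => ?_⟩
    rw [P2_eq_P1_swap, P2_eq_P1_swap]
    exact h B'
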